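/- For all positive integers k and p, the number of domino tilings of the region D(k,2k+1,p) is even. -/

import Mathlib

/-- Two cells of `ℤ × ℤ` are adjacent if they differ by `(1,0)` or `(0,1)`. -/
def Adjacent (a b : ℤ × ℤ) : Prop :=
  (a.1 = b.1 ∧ (a.2 = b.2 + 1 ∨ b.2 = a.2 + 1)) ∨
  (a.2 = b.2 ∧ (a.1 = b.1 + 1 ∨ b.1 = a.1 + 1))

/-- `T` is a domino tiling of `R`: a partition of `R` into two-element sets of adjacent cells. -/
def IsDominoTiling (R : Set (ℤ × ℤ)) (T : Set (Set (ℤ × ℤ))) : Prop :=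
  (∀ d ∈ T, ∃ a b, Adjacent a b ∧ d = {a, b}) ∧
  T.PairwiseDisjoint id ∧
  ⋃₀ T = R

/-- The number of domino tilings of `R`. -/
noncomputable def numTilings (R : Set (ℤ × ℤ)) : ℕ :=
  Nat.card {T : Set (Set (ℤ × ℤ)) // IsDominoTiling R T}

/-- The region `D(i,j,p)`: rows `r = 0, …, i+2p-3` from top to bottom of lengths
`j, j+2, …, j+2(p-2)`, then `i` rows of length `j+2(p-1)`, then `j+2(p-2), …, j+2, j`,
centers aligned. -/
def Dreg (i j p : ℕ) : Set (ℤ × ℤ) :=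
  {q | 0 ≤ q.2 ∧ q.2 ≤ (i : ℤ) + 2 * p - 3 ∧
    (p : ℤ) - 1 - min (min q.2 ((p : ℤ) - 1)) ((i : ℤ) + 2 * p - 3 - q.2) ≤ q.1 ∧
    q.1 ≤ (p : ℤ) - 2 + j + min (min q.2 ((p : ℤ) - 1)) ((i : ℤ) + 2 * p - 3 - q.2)}

theorem Adjacent.symm' {a b : ℤ × ℤ} (h : Adjacent a b) : Adjacent b a := by
  unfold Adjacent at *; omega

theorem Adjacent.ne' {a b : ℤ × ℤ} (h : Adjacent a b) : a ≠ b := by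
  rintro rfl
  unfold Adjacent at h; omega

open Classical in
theorem card_tilings_eq (R : Set (ℤ × ℤ)) :
    Nat.card {σ : Equiv.Perm R // (∀ x, Adjacent (σ x : ℤ × ℤ) x) ∧ ∀ x, σ (σ x) = x}
      = numTilings R := by
  unfold numTilings
  have key : ∀ σ : {σ : Equiv.Perm R // (∀ x, Adjacent (σ x : ℤ × ℤ) x) ∧ ∀ x, σ (σ x) = x},
      IsDominoTiling R {d | ∃ x : R, d = {(x : ℤ × ℤ), (σ.1 x : ℤ × ℤ)}} := by
    rintro ⟨σ, h1, h2⟩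
    refine ⟨?_, ?_, ?_⟩
    · rintro d ⟨x, rfl⟩
      exact ⟨_, _, (h1 x).symm', rfl⟩
    · rintro d ⟨x, rfl⟩ e ⟨y, rfl⟩ hne
      simp only [Function.onFun, id]
      rw [Set.disjoint_left]
      intro z hz hz'
      apply hne
      simp only [Set.mem_insert_iff, Set.mem_singleton_iff] at hz hz'
      rcases hz with hz | hz <;> rcases hz' with hz' | hz'
      · have : x = y := Subtype.ext (hz.symm.trans hz')
        rw [this]
      · have : x = σ y := Subtype.ext (hz.symm.trans hz')
        rw [this, h2, Set.pair_comm]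
      · have : σ x = y := Subtype.ext (hz.symm.trans hz')
        rw [← this, h2, Set.pair_comm]
      · have : σ x = σ y := Subtype.ext (hz.symm.trans hz')
        rw [σ.injective this]
    · ext z
      constructor
      · rintro ⟨d, ⟨x, rfl⟩, hz⟩
        rcases hz with hz | hz
        · rw [hz]; exact x.2
        · rw [hz]; exact (σ x).2
      · intro hz
        exact ⟨_, ⟨⟨z, hz⟩, rfl⟩, Or.inl rfl⟩
  refine Nat.card_eq_of_bijective (fun σ => ⟨_, key σ⟩) ⟨?_, ?_⟩
  · intro σ τ h
    have h' := congrArg Subtype.val h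
    simp only at h'
    apply Subtype.ext
    apply Equiv.ext
    intro x
    have hx : ({(x : ℤ × ℤ), (σ.1 x : ℤ × ℤ)} : Set (ℤ × ℤ)) ∈
        {d | ∃ x : R, d = {(x : ℤ × ℤ), (τ.1 x : ℤ × ℤ)}} := by
      rw [← h']; exact ⟨x, rfl⟩
    obtain ⟨y, hy⟩ := hx
    rcases Set.pair_eq_pair_iff.1 hy with ⟨a, b⟩ | ⟨a, b⟩
    · have a' : x = y := Subtype.ext a
      subst a'
      exact Subtype.ext b
    · have a' : x = τ.1 y := Subtype.ext a
      have b' : σ.1 x = y := Subtype.ext b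
      rw [b', a', τ.2.2]
  · rintro ⟨T, hT1, hT2, hT3⟩
    have ex : ∀ x : R, ∃ y : R, Adjacent (y : ℤ × ℤ) x ∧ ({(x : ℤ × ℤ), (y : ℤ × ℤ)} : Set (ℤ × ℤ)) ∈ T := by
      rintro ⟨x, hx⟩
      rw [← hT3] at hx
      obtain ⟨d, hd, hxd⟩ := hx
      obtain ⟨a, b, hab, rfl⟩ := hT1 d hd
      have ha : a ∈ R := by rw [← hT3]; exact ⟨_, hd, by simp⟩
      have hb : b ∈ R := by rw [← hT3]; exact ⟨_, hd, by simp⟩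
      rcases hxd with rfl | h
      · exact ⟨⟨b, hb⟩, hab.symm', hd⟩
      · have h : x = b := h
        subst h
        exact ⟨⟨a, ha⟩, hab, by rw [Set.pair_comm]; exact hd⟩
    choose f hf1 hf2 using ex
    have uniq : ∀ d ∈ T, ∀ e ∈ T, ∀ z, z ∈ d → z ∈ e → d = e := by
      intro d hd e he z hz hz'
      by_contra hne
      exact Set.disjoint_left.1 (hT2 hd he hne) hz hz'
    have inv : ∀ x, f (f x) = x := by
      intro x
      have h := uniq _ (hf2 x) _ (hf2 (f x)) (f x) (by simp) (by simp)
      rcases Set.pair_eq_pair_iff.1 h with ⟨a, b⟩ | ⟨a, b⟩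
      · exact absurd a.symm (hf1 x).ne'
      · exact Subtype.ext a.symm
    refine ⟨⟨⟨f, f, inv, inv⟩, hf1, inv⟩, ?_⟩
    apply Subtype.ext
    ext d
    constructor
    · rintro ⟨x, rfl⟩
      exact hf2 x
    · intro hd
      obtain ⟨a, b, hab, rfl⟩ := hT1 d hd
      have ha : a ∈ R := by rw [← hT3]; exact ⟨_, hd, by simp⟩
      exact ⟨⟨a, ha⟩, uniq _ hd _ (hf2 ⟨a, ha⟩) a (by simp) (by simp)⟩

open Classical in
theorem even_of_kernel (R : Set (ℤ × ℤ)) [Fintype R] (v : R → ZMod 2) (hv : v ≠ 0)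
    (h : ∀ x : R, ∑ y : R, (if Adjacent (x : ℤ × ℤ) y then v y else 0) = 0) :
    Even (numTilings R) := by
  rw [← card_tilings_eq, ← ZMod.natCast_eq_zero_iff_even]
  let A : Matrix R R (ZMod 2) := fun x y => if Adjacent (x : ℤ × ℤ) y then 1 else 0
  have hdet : A.det = 0 := by
    rw [← Matrix.exists_mulVec_eq_zero_iff]
    refine ⟨v, hv, ?_⟩
    ext x
    have := h x
    simpa [Matrix.mulVec, dotProduct, A] using this
  rw [Matrix.det_apply'] at hdet
  have sgn : ∀ σ : Equiv.Perm R, (((Equiv.Perm.sign σ : ℤˣ) : ℤ) : ZMod 2) = 1 := by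
    intro σ
    rcases Int.units_eq_one_or (Equiv.Perm.sign σ) with h | h <;> rw [h] <;> decide
  have prd : ∀ σ : Equiv.Perm R, ∏ i, A (σ i) i =
      if (∀ x, Adjacent (σ x : ℤ × ℤ) x) then 1 else 0 := by
    intro σ
    simp only [A]
    rw [Finset.prod_ite_zero]
    simp
  simp only [sgn, prd, one_mul] at hdet
  rw [Nat.card_eq_fintype_card, Fintype.card_subtype, Finset.natCast_card_filter]
  refine Eq.trans ?_ hdet
  rw [← sub_eq_zero, ← Finset.sum_sub_distrib]
  refine Finset.sum_involution (fun σ _ => σ⁻¹) ?_ ?_ ?_ ?_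
  · intro σ _
    have e1 : (∀ x, Adjacent (σ⁻¹ x : ℤ × ℤ) x) ↔ (∀ x, Adjacent (σ x : ℤ × ℤ) x) := by
      constructor
      · intro h x
        have := h (σ x)
        have e : σ⁻¹ (σ x) = x := by simp
        rw [e] at this
        exact this.symm'
      · intro h x
        have := h (σ⁻¹ x)
        have e : σ (σ⁻¹ x) = x := by simp
        rw [e] at this
        exact this.symm'
    have e2 : (∀ x, σ⁻¹ (σ⁻¹ x) = x) ↔ (∀ x, σ (σ x) = x) := by
      constructor
      · intro h x
        have := h (σ (σ x))
        simpa using this.symm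
      · intro h x
        have := h (σ⁻¹ (σ⁻¹ x))
        simpa using this.symm
    simp only [e1, e2]
    exact CharTwo.add_self_eq_zero _
  · intro σ _ hne he
    apply hne
    have : ∀ x, σ (σ x) = x := by
      intro x
      have e : σ⁻¹ (σ x) = x := by simp
      rwa [he] at e
    simp [this]
  · simp
  · simp

open Classical in
theorem sum_adj (R : Set (ℤ × ℤ)) [Fintype R] (w : ℤ × ℤ → ZMod 2) (hw : ∀ y, y ∉ R → w y = 0)
    (x : ℤ × ℤ) :
    ∑ y : R, (if Adjacent x y then w y else 0) =
      w (x.1 + 1, x.2) + w (x.1 - 1, x.2) + w (x.1, x.2 + 1) + w (x.1, x.2 - 1) := by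
  let N : Finset (ℤ × ℤ) := {(x.1 + 1, x.2), (x.1 - 1, x.2), (x.1, x.2 + 1), (x.1, x.2 - 1)}
  have hN : ∀ y, Adjacent x y ↔ y ∈ N := by
    rintro ⟨a, b⟩
    simp only [N, Finset.mem_insert, Finset.mem_singleton, Prod.mk.injEq, Adjacent]
    omega
  have h1 : ∑ y : R, (if Adjacent x y then w y else 0) =
      ∑ y ∈ R.toFinset, (if Adjacent x y then w y else 0) := by
    rw [← Finset.sum_coe_sort R.toFinset]
    exact Fintype.sum_equiv (Equiv.subtypeEquivRight (by simp)) _ _ (fun _ => rfl)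
  have h2 : ∑ y ∈ R.toFinset, (if Adjacent x y then w y else 0) = ∑ y ∈ N, w y := by
    simp only [hN]
    rw [← Finset.sum_filter]
    apply Finset.sum_subset_zero_on_sdiff
    · intro y hy; exact (Finset.mem_filter.1 hy).2
    · intro y hy
      apply hw
      simp only [Finset.mem_sdiff, Finset.mem_filter, Set.mem_toFinset] at hy
      tauto
    · intros; rfl
  rw [h1, h2]
  simp only [N]
  rw [Finset.sum_insert, Finset.sum_insert, Finset.sum_insert, Finset.sum_singleton]
  · ring
  all_goals
    simp only [Finset.mem_insert, Finset.mem_singleton, Prod.mk.injEq]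
    omega

theorem Dreg_finite (i j p : ℕ) : (Dreg i j p).Finite := by
  apply (Set.finite_Icc ((0 : ℤ), (0 : ℤ)) ((2 * p + j : ℤ), (i + 2 * p : ℤ))).subset
  rintro ⟨a, b⟩ ⟨h1, h2, h3, h4⟩
  simp only at h1 h2 h3 h4
  simp only [Set.mem_Icc, Prod.mk_le_mk]
  omega

theorem mem_D (k p : ℕ) (c r : ℤ) : (c, r) ∈ Dreg k (2 * k + 1) p ↔
    0 ≤ r ∧ r ≤ (k : ℤ) + 2 * p - 3 ∧
    (p : ℤ) - 1 - min (min r ((p : ℤ) - 1)) ((k : ℤ) + 2 * p - 3 - r) ≤ c ∧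
    c ≤ (p : ℤ) - 2 + (2 * k + 1) + min (min r ((p : ℤ) - 1)) ((k : ℤ) + 2 * p - 3 - r) := by
  simp [Dreg]

open Classical in
theorem D_k_2k1_even (k p : ℕ) (hk : 0 < k) (hp : 0 < p) :
    Even (numTilings (Dreg k (2 * k + 1) p)) := by
  have : Fintype (Dreg k (2 * k + 1) p) := (Dreg_finite _ _ _).fintype
  let w : ℤ × ℤ → ZMod 2 := fun y =>
    if y ∈ Dreg k (2 * k + 1) p ∧ (y.2 - y.1 = p - 1 ∨ y.2 + y.1 = 3 * (p - 1) + 2 * k) then 1 else 0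
  apply even_of_kernel _ (fun y => w y)
  · intro h0
    have hm : ((0 : ℤ), (p - 1 : ℤ)) ∈ Dreg k (2 * k + 1) p := by
      rw [mem_D]; omega
    have := congrFun h0 ⟨_, hm⟩
    simp [w, hm] at this
  · rintro ⟨⟨c, r⟩, hx⟩
    rw [sum_adj _ w (by intro y hy; simp [w, hy])]
    rw [mem_D] at hx
    simp only [w, mem_D]
    split_ifs <;> first | decide | (exfalso; omega)
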